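/- For every labelled linear ordering M = (ℕ, <, P₁, …, Pₙ) there exists a set H ⊆ ℕ that is uniformly homogeneous for M and is recursive in (Turing reducible to) the MSO theory of M. -/

import Mathlib

namespace Paper

/-! ## Syntax and semantics of monadic second-order logic over labelled linear orders

A labelled linear ordering `M = (A, <, P₁, …, Pₙ)` is represented by a type `A`,
a binary relation `r : A → A → Prop` (the order) and `P : Fin n → Set A`
(the unary predicates). -/

/-- MSO formulas over the signature `{<, P₀, …, P_{n-1}}`.  First-order
variables and second-order (set) variables are both indexed by `ℕ`. -/
inductive MSO (n : ℕ) : Type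
  | lt (i j : ℕ) : MSO n
  | pred (k : Fin n) (i : ℕ) : MSO n
  | mem (i j : ℕ) : MSO n
  | not (φ : MSO n) : MSO n
  | and (φ ψ : MSO n) : MSO n
  | ex1 (i : ℕ) (φ : MSO n) : MSO n
  | ex2 (j : ℕ) (φ : MSO n) : MSO n

namespace MSO

variable {n : ℕ}

/-- Satisfaction of an MSO formula in the structure `(A, r, P)` under the
first-order assignment `v` and the second-order assignment `V`. -/
def Sat {A : Type} (r : A → A → Prop) (P : Fin n → Set A)
    (v : ℕ → A) (V : ℕ → Set A) : MSO n → Prop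
  | lt i j => r (v i) (v j)
  | pred k i => v i ∈ P k
  | mem i j => v i ∈ V j
  | not φ => ¬ Sat r P v V φ
  | and φ ψ => Sat r P v V φ ∧ Sat r P v V ψ
  | ex1 i φ => ∃ a : A, Sat r P (Function.update v i a) V φ
  | ex2 j φ => ∃ S : Set A, Sat r P v (Function.update V j S) φ

/-- Quantifier depth of an MSO formula. -/
def qd : MSO n → ℕ
  | lt _ _ => 0
  | pred _ _ => 0
  | mem _ _ => 0
  | not φ => qd φ
  | and φ ψ => max (qd φ) (qd ψ)
  | ex1 _ φ => qd φ + 1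
  | ex2 _ φ => qd φ + 1

/-- Free first-order variables of an MSO formula. -/
def fv1 : MSO n → Finset ℕ
  | lt i j => {i, j}
  | pred _ i => {i}
  | mem i _ => {i}
  | not φ => fv1 φ
  | and φ ψ => fv1 φ ∪ fv1 ψ
  | ex1 i φ => fv1 φ \ {i}
  | ex2 _ φ => fv1 φ

/-- Free second-order variables of an MSO formula. -/
def fv2 : MSO n → Finset ℕ
  | lt _ _ => ∅
  | pred _ _ => ∅
  | mem _ j => {j}
  | not φ => fv2 φ
  | and φ ψ => fv2 φ ∪ fv2 ψ
  | ex1 _ φ => fv2 φ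
  | ex2 j φ => fv2 φ \ {j}

/-- A sentence is a formula with no free variables. -/
def IsSentence (φ : MSO n) : Prop := fv1 φ = ∅ ∧ fv2 φ = ∅

/-- A sentence `φ` is true in the structure `(A, r, P)`. -/
def TrueIn {A : Type} (r : A → A → Prop) (P : Fin n → Set A) (φ : MSO n) : Prop :=
  ∀ (v : ℕ → A) (V : ℕ → Set A), Sat r P v V φ

/-- `Q ⊆ A` is MSO-definable in `(A, r, P)`: there is a formula `φ(x)` whose only
free variable is the first-order variable `0` defining `Q`. -/
def Definable {A : Type} (r : A → A → Prop) (P : Fin n → Set A) (Q : Set A) : Prop :=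
  ∃ φ : MSO n, fv1 φ ⊆ {0} ∧ fv2 φ = ∅ ∧
    ∀ a : A, a ∈ Q ↔ ∀ (v : ℕ → A) (V : ℕ → Set A), Sat r P (Function.update v 0 a) V φ

/-- A Gödel numbering of MSO formulas. -/
def encode : MSO n → ℕ
  | lt i j => Nat.pair 0 (Nat.pair i j)
  | pred k i => Nat.pair 1 (Nat.pair k i)
  | mem i j => Nat.pair 2 (Nat.pair i j)
  | not φ => Nat.pair 3 (encode φ)
  | and φ ψ => Nat.pair 4 (Nat.pair (encode φ) (encode ψ))
  | ex1 i φ => Nat.pair 5 (Nat.pair i (encode φ))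
  | ex2 j φ => Nat.pair 6 (Nat.pair j (encode φ))

/-- The MSO theory of the structure `(A, r, P)`, as a set of Gödel codes of the true
sentences. -/
def TheoryCodes {A : Type} (r : A → A → Prop) (P : Fin n → Set A) : Set ℕ :=
  {c | ∃ φ : MSO n, IsSentence φ ∧ encode φ = c ∧ TrueIn r P φ}

/-- Two structures have the same `k`-type: they satisfy the same MSO sentences of
quantifier depth `≤ k`. -/
def EquivType (k : ℕ) {A B : Type} (r : A → A → Prop) (P : Fin n → Set A)
    (s : B → B → Prop) (Q : Fin n → Set B) : Prop :=
  ∀ φ : MSO n, IsSentence φ → qd φ ≤ k → (TrueIn r P φ ↔ TrueIn s Q φ)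

/-- The `k`-type of a structure, as the set of Gödel codes of the true sentences
of quantifier depth `≤ k`. -/
def TypeSet (k : ℕ) {A : Type} (r : A → A → Prop) (P : Fin n → Set A) : Set ℕ :=
  {c | ∃ φ : MSO n, IsSentence φ ∧ qd φ ≤ k ∧ encode φ = c ∧ TrueIn r P φ}

end MSO

/-- The order relation of the substructure with domain `S`. -/
def subRel {A : Type} (r : A → A → Prop) (S : Set A) : S → S → Prop :=
  fun x y => r x y

/-- The predicates of the substructure with domain `S`. -/
def subPred {A : Type} {n : ℕ} (P : Fin n → Set A) (S : Set A) : Fin n → Set S :=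
  fun k => {x : S | (x : A) ∈ P k}

/-! ## Relative computability -/

/-- Partial recursiveness relative to an oracle `O` (Kleene-style, following
the definition of `Nat.Partrec`, with an extra base case for the oracle). -/
inductive RecursiveIn (O : ℕ →. ℕ) : (ℕ →. ℕ) → Prop
  | zero : RecursiveIn O (pure 0)
  | succ : RecursiveIn O ↑Nat.succ
  | left : RecursiveIn O ↑fun n : ℕ => n.unpair.1
  | right : RecursiveIn O ↑fun n : ℕ => n.unpair.2
  | oracle : RecursiveIn O O
  | pair {f g} : RecursiveIn O f → RecursiveIn O g →
      RecursiveIn O fun n => Nat.pair <$> f n <*> g n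
  | comp {f g} : RecursiveIn O f → RecursiveIn O g →
      RecursiveIn O fun n => g n >>= f
  | prec {f g} : RecursiveIn O f → RecursiveIn O g →
      RecursiveIn O (Nat.unpaired fun a m =>
        m.rec (f a) fun y IH => do let i ← IH; g (Nat.pair a (Nat.pair y i)))
  | rfind {f} : RecursiveIn O f →
      RecursiveIn O fun a => Nat.rfind fun m => (fun x => x = 0) <$> f (Nat.pair a m)

/-- The characteristic (partial) function of a set of naturals. -/
noncomputable def chi (S : Set ℕ) : ℕ →. ℕ :=
  fun m => Part.some (S.indicator (fun _ => 1) m)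

/-- `S` is recursive in (Turing reducible to) `T`. -/
def TuringRed (S T : Set ℕ) : Prop := RecursiveIn (chi T) (chi S)

/-- The (recursive) join of a finite family of sets of naturals. -/
def finJoin {m : ℕ} (P : Fin m → Set ℕ) : Set ℕ :=
  {c | ∃ i : Fin m, ∃ x : ℕ, c = Nat.pair i x ∧ x ∈ P i}

/-- The (recursive) join of two sets of naturals. -/
def setJoin (S T : Set ℕ) : Set ℕ :=
  {c | (∃ a, c = 2 * a ∧ a ∈ S) ∨ (∃ a, c = 2 * a + 1 ∧ a ∈ T)}

/-- A set of naturals is decidable (computable). -/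
def DecidableSet (S : Set ℕ) : Prop := ComputablePred (· ∈ S)

/-! ## Homogeneous sets for labelled orderings of the naturals -/

/-- `H = {h 0 < h 1 < ⋯}` is `k`-homogeneous for `(ℕ, <, P)`:
all substructures `M_{[h i, h j)}`, `i < j`, have the same `k`-type. -/
def KHomogeneous {n : ℕ} (P : Fin n → Set ℕ) (h : ℕ → ℕ) (k : ℕ) : Prop :=
  ∀ i j i' j' : ℕ, i < j → i' < j' →
    MSO.EquivType k
      (subRel (· < ·) (Set.Ico (h i) (h j))) (subPred P (Set.Ico (h i) (h j)))
      (subRel (· < ·) (Set.Ico (h i') (h j'))) (subPred P (Set.Ico (h i') (h j')))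

/-- `H = {h 0 < h 1 < ⋯}` is uniformly homogeneous for `(ℕ, <, P)`:
for each `k`, the set `{h k < h (k+1) < ⋯}` is `k`-homogeneous. -/
def UniformlyHomogeneous {n : ℕ} (P : Fin n → Set ℕ) (h : ℕ → ℕ) : Prop :=
  StrictMono h ∧
  ∀ k : ℕ, KHomogeneous P (fun i => h (k + i)) k

/-! ## ℤ-words -/

/-- The finite word `u` occurs at position `i` in the `ℤ`-word `w`. -/
def OccursAt {σ : Type} (w : ℤ → σ) (u : List σ) (i : ℤ) : Prop :=
  ∀ k : Fin u.length, w (i + (k : ℕ)) = u.get k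

/-- The finite word `u` occurs in the `ℤ`-word `w`. -/
def OccursIn {σ : Type} (w : ℤ → σ) (u : List σ) : Prop :=
  ∃ i : ℤ, OccursAt w u i

/-- `u` occurs in every prefix of `w`. -/
def InEveryPrefix {σ : Type} (w : ℤ → σ) (u : List σ) : Prop :=
  ∀ n : ℤ, ∃ i : ℤ, i + u.length ≤ n ∧ OccursAt w u i

/-- `u` occurs in every suffix of `w`. -/
def InEverySuffix {σ : Type} (w : ℤ → σ) (u : List σ) : Prop :=
  ∀ n : ℤ, ∃ i : ℤ, n ≤ i ∧ OccursAt w u i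

/-- A `ℤ`-word `w` is recurrent: for every regular language `X`, either no element
of `X` occurs in `w`, or every prefix and every suffix of `w` contains an
occurrence of some element of `X`. -/
def Recurrent {σ : Type} (w : ℤ → σ) : Prop :=
  ∀ X : Language σ, X.IsRegular →
    (∀ u ∈ X, ¬ OccursIn w u) ∨
    (∀ n : ℤ, (∃ u ∈ X, ∃ i : ℤ, i + u.length ≤ n ∧ OccursAt w u i) ∧
              (∃ u ∈ X, ∃ i : ℤ, n ≤ i ∧ OccursAt w u i))

/-- The `ℤ`-word `w(M)` over the alphabet `{0,1}ⁿ` associated with the labelled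
linear ordering `M = (ℤ, <, P₁, …, Pₙ)`. -/
def wordOf {n : ℕ} (P : Fin n → Set ℤ) : ℤ → (Fin n → Prop) :=
  fun i k => i ∈ P k

end Paper

namespace Paper

namespace MSO

variable {n : ℕ}

/-! ## Derived connectives and the formulas used by the construction -/

/-- Implication. -/
def imp (φ ψ : MSO n) : MSO n := not (and φ (not ψ))

/-- Biconditional. -/
def iff (φ ψ : MSO n) : MSO n := and (imp φ ψ) (imp ψ φ)

/-- First-order universal quantification. -/
def all1 (i : ℕ) (φ : MSO n) : MSO n := not (ex1 i (not φ))

/-- Second-order universal quantification. -/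
def all2 (j : ℕ) (φ : MSO n) : MSO n := not (ex2 j (not φ))

/-- A formula that is true in every strict order. -/
def verum : MSO n := not (ex1 0 (lt 0 0))

/-- The conjunction of `f 0, …, f (m - 1)`. -/
def conj (m : ℕ) (f : ℕ → MSO n) : MSO n := Nat.rec verum (fun i ψ => and (f i) ψ) m

/-- The formula `x_a ≤ x_p < x_b`. -/
def between (a p b : ℕ) : MSO n := and (not (lt p a)) (lt p b)

/-- The points with numbers `5 + 2i` and `6 + 2i` carry the same labels. -/
def sameLabels (i : ℕ) : MSO n :=
  (List.finRange n).foldr (fun l ψ => and (iff (pred l (5 + 2 * i)) (pred l (6 + 2 * i))) ψ) verum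

/-- The moves of rounds `0, …, m - 1` of the back-and-forth game agree on atomic formulas.
Round `i` has the points `5 + 2i`, `6 + 2i` and the sets `1 + 2i`, `2 + 2i`. -/
def agree (m : ℕ) : MSO n :=
  conj m fun i => conj m fun j =>
    and (iff (lt (5 + 2 * i) (5 + 2 * j)) (lt (6 + 2 * i) (6 + 2 * j)))
      (and (iff (mem (5 + 2 * i) (1 + 2 * j)) (mem (6 + 2 * i) (2 + 2 * j))) (sameLabels i))

/-- One round of the back-and-forth game between `[x₁, x₂)` and `[x₃, x₄)`. -/
def gameRound (r : ℕ) (φ : MSO n) : MSO n :=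
  and
    (all1 (5 + 2 * r) (imp (between 1 (5 + 2 * r) 2) (all2 (1 + 2 * r)
      (ex1 (6 + 2 * r) (and (between 3 (6 + 2 * r) 4) (ex2 (2 + 2 * r) φ))))))
    (all1 (6 + 2 * r) (imp (between 3 (6 + 2 * r) 4) (all2 (2 + 2 * r)
      (ex1 (5 + 2 * r) (and (between 1 (5 + 2 * r) 2) (ex2 (1 + 2 * r) φ))))))

/-- The last `i` rounds of the back-and-forth game with `m` rounds. -/
def game (m i : ℕ) : MSO n := Nat.rec (agree m) (fun i ψ => gameRound (m - (i + 1)) ψ) i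

/-- All intervals `[a, b)` with `x₀ ≤ a < b` in `X₀` are indistinguishable in `k` rounds. -/
def hom (k : ℕ) : MSO n :=
  all1 1 <| all1 2 <| all1 3 <| all1 4 <|
    imp (and (not (lt 1 0)) (and (lt 1 2) (and (mem 1 0) (mem 2 0)))) <|
    imp (and (not (lt 3 0)) (and (lt 3 4) (and (mem 3 0) (mem 4 0)))) (game k k)

/-- The formula stating that `x_{m+1}` is the number `m`. -/
def literal (m : ℕ) : MSO n :=
  Nat.rec (not (ex1 0 (lt 0 1)))
    (fun i ψ => ex1 (i + 1) (and ψ (and (lt (i + 1) (i + 2))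
      (not (ex1 0 (and (lt (i + 1) 0) (lt 0 (i + 2)))))))) m

/-- The formula stating that `x₀` is the number `m`. -/
def isNum (m : ℕ) : MSO n :=
  ex1 (m + 1) (and (literal m) (and (not (lt 0 (m + 1))) (not (lt (m + 1) 0))))

/-- The formula stating that `X₀` satisfies `φ`, contains `m`, and that its part from `m` on is
homogeneous for the game with `k` rounds. -/
def accept (k m : ℕ) (φ : MSO n) : MSO n :=
  and φ (ex1 0 (and (isNum m) (and (mem 0 0) (hom k))))

/-- The formula stating that `X₀` satisfies `φ` and does not contain `m`. -/
def reject (m : ℕ) (φ : MSO n) : MSO n :=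
  and φ (not (ex1 0 (and (isNum m) (mem 0 0))))

/-- The formula stating that some infinite `X₀` satisfies `φ`. -/
def someInfinite (φ : MSO n) : MSO n :=
  ex2 0 (and (all1 1 (ex1 2 (and (lt 1 2) (mem 2 0)))) φ)

/-- Existential quantification over all variables below `N`. -/
def close (N : ℕ) (φ : MSO n) : MSO n := Nat.rec φ (fun i ψ => ex1 i (ex2 i ψ)) N

/-! ## Computability of operations on formulas -/

/-- The operation `g` on formulas is primitive recursive in the parameter and the code. -/
def PrimOp {α : Type} [Primcodable α] (g : α → MSO n → MSO n) : Prop :=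
  ∃ g' : α → ℕ → ℕ, Primrec₂ g' ∧ ∀ a φ, (g a φ).encode = g' a φ.encode

namespace PrimOp

variable {α β : Type} [Primcodable α] [Primcodable β]

theorem id : PrimOp (fun (_ : α) (φ : MSO n) => φ) :=
  ⟨fun _ c => c, Primrec.snd, fun _ _ => rfl⟩

theorem param {g : β → MSO n → MSO n} (hg : PrimOp g) {f : α → β} (hf : Primrec f) :
    PrimOp (fun a φ => g (f a) φ) := by
  obtain ⟨g', h, e⟩ := hg
  exact ⟨fun a c => g' (f a) c, h.comp (hf.comp Primrec.fst) Primrec.snd, fun a φ => e _ _⟩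

theorem tag {f : α → ℕ} (t : ℕ) (hf : Primrec f) :
    Primrec₂ (fun (a : α) (_ : ℕ) => Nat.pair t (f a)) :=
  Primrec₂.natPair.comp (Primrec.const t) (hf.comp Primrec.fst)

theorem lt {f g : α → ℕ} (hf : Primrec f) (hg : Primrec g) :
    PrimOp (fun a (_ : MSO n) => MSO.lt (f a) (g a)) :=
  ⟨_, tag 0 (Primrec₂.natPair.comp hf hg), fun _ _ => rfl⟩

theorem pred {f : α → ℕ} (l : Fin n) (hf : Primrec f) :
    PrimOp (fun a (_ : MSO n) => MSO.pred l (f a)) :=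
  ⟨_, tag 1 (Primrec₂.natPair.comp (Primrec.const (l : ℕ)) hf), fun _ _ => rfl⟩

theorem mem {f g : α → ℕ} (hf : Primrec f) (hg : Primrec g) :
    PrimOp (fun a (_ : MSO n) => MSO.mem (f a) (g a)) :=
  ⟨_, tag 2 (Primrec₂.natPair.comp hf hg), fun _ _ => rfl⟩

theorem not {g : α → MSO n → MSO n} (hg : PrimOp g) : PrimOp (fun a φ => MSO.not (g a φ)) := by
  obtain ⟨g', h, e⟩ := hg
  exact ⟨fun a c => Nat.pair 3 (g' a c), Primrec₂.natPair.comp (Primrec.const 3) h,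
    fun a φ => by simp [encode, e]⟩

theorem and {f g : α → MSO n → MSO n} (hf : PrimOp f) (hg : PrimOp g) :
    PrimOp (fun a φ => MSO.and (f a φ) (g a φ)) := by
  obtain ⟨f', h, e⟩ := hf
  obtain ⟨g', h', e'⟩ := hg
  exact ⟨fun a c => Nat.pair 4 (Nat.pair (f' a c) (g' a c)),
    Primrec₂.natPair.comp (Primrec.const 4) (Primrec₂.natPair.comp h h'),
    fun a φ => by simp [encode, e, e']⟩

theorem ex1 {f : α → ℕ} {g : α → MSO n → MSO n} (hf : Primrec f) (hg : PrimOp g) :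
    PrimOp (fun a φ => MSO.ex1 (f a) (g a φ)) := by
  obtain ⟨g', h, e⟩ := hg
  exact ⟨fun a c => Nat.pair 5 (Nat.pair (f a) (g' a c)),
    Primrec₂.natPair.comp (Primrec.const 5) (Primrec₂.natPair.comp (hf.comp Primrec.fst) h),
    fun a φ => by simp [encode, e]⟩

theorem ex2 {f : α → ℕ} {g : α → MSO n → MSO n} (hf : Primrec f) (hg : PrimOp g) :
    PrimOp (fun a φ => MSO.ex2 (f a) (g a φ)) := by
  obtain ⟨g', h, e⟩ := hg
  exact ⟨fun a c => Nat.pair 6 (Nat.pair (f a) (g' a c)),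
    Primrec₂.natPair.comp (Primrec.const 6) (Primrec₂.natPair.comp (hf.comp Primrec.fst) h),
    fun a φ => by simp [encode, e]⟩

theorem nat_rec {m : α → ℕ} {f : α → MSO n → MSO n} {g : α × ℕ → MSO n → MSO n}
    (hm : Primrec m) (hf : PrimOp f) (hg : PrimOp g) :
    PrimOp (fun a φ => Nat.rec (f a φ) (fun i ψ => g (a, i) ψ) (m a)) := by
  obtain ⟨f', h, e⟩ := hf
  obtain ⟨g', h', e'⟩ := hg
  refine ⟨fun a c => Nat.rec (f' a c) (fun i d => g' (a, i) d) (m a), ?_, ?_⟩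
  · exact Primrec.nat_rec' (f := fun p : α × ℕ => m p.1) (g := fun p : α × ℕ => f' p.1 p.2)
      (h := fun (p : α × ℕ) (q : ℕ × ℕ) => g' (p.1, q.1) q.2)
      (hm.comp Primrec.fst) h
      (h'.comp
        (Primrec.pair (Primrec.fst.comp Primrec.fst) (Primrec.fst.comp Primrec.snd))
        (Primrec.snd.comp Primrec.snd))
  · intro a φ
    dsimp only
    induction m a with
    | zero => exact e _ _
    | succ i ih => exact (e' _ _).trans (congrArg _ ih)

theorem imp {f g : α → MSO n → MSO n} (hf : PrimOp f) (hg : PrimOp g) :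
    PrimOp (fun a φ => MSO.imp (f a φ) (g a φ)) :=
  (hf.and hg.not).not

theorem iff {f g : α → MSO n → MSO n} (hf : PrimOp f) (hg : PrimOp g) :
    PrimOp (fun a φ => MSO.iff (f a φ) (g a φ)) :=
  (hf.imp hg).and (hg.imp hf)

theorem all1 {f : α → ℕ} {g : α → MSO n → MSO n} (hf : Primrec f) (hg : PrimOp g) :
    PrimOp (fun a φ => MSO.all1 (f a) (g a φ)) :=
  (hg.not.ex1 hf).not

theorem all2 {f : α → ℕ} {g : α → MSO n → MSO n} (hf : Primrec f) (hg : PrimOp g) :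
    PrimOp (fun a φ => MSO.all2 (f a) (g a φ)) :=
  (hg.not.ex2 hf).not

theorem verum : PrimOp (fun (_ : α) (_ : MSO n) => MSO.verum) :=
  ((lt (Primrec.const 0) (Primrec.const 0)).ex1 (Primrec.const 0)).not

theorem between {a p b : α → ℕ} (ha : Primrec a) (hp : Primrec p) (hb : Primrec b) :
    PrimOp (fun x (_ : MSO n) => MSO.between (a x) (p x) (b x)) :=
  (lt hp ha).not.and (lt hp hb)

theorem conj {m : α → ℕ} {f : α → ℕ → MSO n} (hm : Primrec m)
    (hf : PrimOp (fun (p : α × ℕ) (_ : MSO n) => f p.1 p.2)) :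
    PrimOp (fun a (_ : MSO n) => MSO.conj (m a) (f a)) :=
  nat_rec hm verum (hf.and id)

end PrimOp

theorem primrec_var (a : ℕ) : Primrec (fun i => a + 2 * i) :=
  Primrec.nat_add.comp (Primrec.const a) (Primrec.nat_mul.comp (Primrec.const 2) Primrec.id)

theorem primOp_sameLabels : PrimOp (fun (i : ℕ) (_ : MSO n) => sameLabels i) := by
  unfold sameLabels
  induction List.finRange n with
  | nil => exact PrimOp.verum
  | cons l L ih =>
    exact ((PrimOp.pred l (primrec_var 5)).iff (PrimOp.pred l (primrec_var 6))).and ih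

theorem primOp_agree : PrimOp (fun (m : ℕ) (_ : MSO n) => agree m) := by
  have hi : Primrec (fun p : (ℕ × ℕ) × ℕ => p.1.2) := Primrec.snd.comp Primrec.fst
  have hj : Primrec (fun p : (ℕ × ℕ) × ℕ => p.2) := Primrec.snd
  refine PrimOp.conj Primrec.id (PrimOp.conj (α := ℕ × ℕ) Primrec.fst ?_)
  exact ((PrimOp.lt ((primrec_var 5).comp hi) ((primrec_var 5).comp hj)).iff
    (PrimOp.lt ((primrec_var 6).comp hi) ((primrec_var 6).comp hj))).and
    (((PrimOp.mem ((primrec_var 5).comp hi) ((primrec_var 1).comp hj)).iff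
    (PrimOp.mem ((primrec_var 6).comp hi) ((primrec_var 2).comp hj))).and
    (primOp_sameLabels.param hi))

theorem primOp_gameRound : PrimOp (fun (r : ℕ) (φ : MSO n) => gameRound r φ) := by
  have c (a : ℕ) : Primrec (fun _ : ℕ => a) := Primrec.const a
  have v := primrec_var
  have b₁ : PrimOp (fun r (_ : MSO n) => between 1 (5 + 2 * r) 2) :=
    PrimOp.between (c 1) (v 5) (c 2)
  have b₂ : PrimOp (fun r (_ : MSO n) => between 3 (6 + 2 * r) 4) :=
    PrimOp.between (c 3) (v 6) (c 4)
  exact ((b₁.imp ((b₂.and (PrimOp.id.ex2 (v 2))).ex1 (v 6) |>.all2 (v 1))).all1 (v 5)).and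
    ((b₂.imp ((b₁.and (PrimOp.id.ex2 (v 1))).ex1 (v 5) |>.all2 (v 2))).all1 (v 6))

theorem primOp_game : PrimOp (fun (k : ℕ) (_ : MSO n) => game k k) :=
  PrimOp.nat_rec Primrec.id primOp_agree (primOp_gameRound.param
    (Primrec.nat_sub.comp Primrec.fst (Primrec.succ.comp Primrec.snd)))

theorem primOp_hom : PrimOp (fun (k : ℕ) (_ : MSO n) => hom k) := by
  have c (a : ℕ) : Primrec (fun _ : ℕ => a) := Primrec.const a
  have member (a b : ℕ) : PrimOp (fun (_ : ℕ) (_ : MSO n) =>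
      and (not (lt a 0)) (and (lt a b) (and (mem a 0) (mem b 0)))) :=
    (PrimOp.lt (c a) (c 0)).not.and ((PrimOp.lt (c a) (c b)).and
      ((PrimOp.mem (c a) (c 0)).and (PrimOp.mem (c b) (c 0))))
  exact ((((((member 1 2).imp ((member 3 4).imp primOp_game)).all1 (c 4)).all1 (c 3)).all1
    (c 2)).all1 (c 1))

theorem primOp_literal : PrimOp (fun (m : ℕ) (_ : MSO n) => literal m) := by
  have c (a : ℕ) : Primrec (fun _ : ℕ × ℕ => a) := Primrec.const a
  have h₁ : Primrec (fun p : ℕ × ℕ => p.2 + 1) := Primrec.succ.comp Primrec.snd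
  have h₂ : Primrec (fun p : ℕ × ℕ => p.2 + 2) := Primrec.succ.comp h₁
  exact PrimOp.nat_rec Primrec.id
    (((PrimOp.lt (Primrec.const 0) (Primrec.const 1)).ex1 (Primrec.const 0)).not)
    ((PrimOp.id.and ((PrimOp.lt h₁ h₂).and
      (((PrimOp.lt h₁ (c 0)).and (PrimOp.lt (c 0) h₂)).ex1 (c 0)).not)).ex1 h₁)

theorem primOp_isNum : PrimOp (fun (m : ℕ) (_ : MSO n) => isNum m) :=
  (primOp_literal.and ((PrimOp.lt (Primrec.const 0) Primrec.succ).not.and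
    (PrimOp.lt Primrec.succ (Primrec.const 0)).not)).ex1 Primrec.succ

theorem primOp_accept : PrimOp (fun (p : ℕ × ℕ) (φ : MSO n) => accept p.1 p.2 φ) :=
  PrimOp.id.and (((primOp_isNum.param Primrec.snd).and
    ((PrimOp.mem (Primrec.const 0) (Primrec.const 0)).and
      (primOp_hom.param Primrec.fst))).ex1 (Primrec.const 0))

theorem primOp_reject : PrimOp (fun (m : ℕ) (φ : MSO n) => reject m φ) :=
  PrimOp.id.and ((primOp_isNum.and
    (PrimOp.mem (Primrec.const 0) (Primrec.const 0))).ex1 (Primrec.const 0)).not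

theorem primOp_someInfinite : PrimOp (fun (_ : ℕ) (φ : MSO n) => someInfinite φ) :=
  PrimOp.ex2 (Primrec.const 0) (((((PrimOp.lt (Primrec.const 1) (Primrec.const 2)).and
    (PrimOp.mem (Primrec.const 2) (Primrec.const 0))).ex1 (Primrec.const 2)).all1
      (Primrec.const 1)).and PrimOp.id)

theorem primOp_close : PrimOp (fun (N : ℕ) (φ : MSO n) => close N φ) :=
  PrimOp.nat_rec Primrec.id PrimOp.id ((PrimOp.id.ex2 Primrec.snd).ex1 Primrec.snd)

/-! ## Codes of sentences -/

theorem encode_injective : Function.Injective (encode : MSO n → ℕ) := by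
  intro φ
  induction φ with
  | lt i j => rintro (_ | _) h <;> simp_all [encode]
  | pred l i => rintro (_ | _) h <;> simp_all [encode, Fin.ext_iff]
  | mem i j => rintro (_ | _) h <;> simp_all [encode]
  | not φ ih =>
    rintro (_ | _) h <;> simp [encode] at h ⊢
    exact ih h
  | and φ ψ ih ih' =>
    rintro (_ | _) h <;> simp [encode] at h ⊢
    exact ⟨ih h.1, ih' h.2⟩
  | ex1 i φ ih =>
    rintro (_ | _) h <;> simp [encode] at h ⊢
    exact ⟨h.1, ih h.2⟩
  | ex2 i φ ih =>
    rintro (_ | _) h <;> simp [encode] at h ⊢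
    exact ⟨h.1, ih h.2⟩

theorem le_encode (φ : MSO n) : (∀ i ∈ fv1 φ, i ≤ encode φ) ∧ ∀ j ∈ fv2 φ, j ≤ encode φ := by
  have l := Nat.left_le_pair
  have r := Nat.right_le_pair
  induction φ with
  | lt i j =>
    have := r 0 (Nat.pair i j)
    have := l i j
    have := r i j
    simp only [fv1, fv2, encode]
    grind
  | pred k i =>
    have := r 1 (Nat.pair k i)
    have := r k i
    simp only [fv1, fv2, encode]
    grind
  | mem i j =>
    have := r 2 (Nat.pair i j)
    have := l i j
    have := r i j
    simp only [fv1, fv2, encode]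
    grind
  | not φ ih =>
    have := r 3 (encode φ)
    simp only [fv1, fv2, encode]
    grind
  | and φ ψ ih ih' =>
    have := r 4 (Nat.pair (encode φ) (encode ψ))
    have := l (encode φ) (encode ψ)
    have := r (encode φ) (encode ψ)
    simp only [fv1, fv2, encode]
    grind
  | ex1 i φ ih =>
    have := r 5 (Nat.pair i (encode φ))
    have := r i (encode φ)
    simp only [fv1, fv2, encode]
    grind
  | ex2 i φ ih =>
    have := r 6 (Nat.pair i (encode φ))
    have := r i (encode φ)
    simp only [fv1, fv2, encode]
    grind

theorem mem_fv_close (N : ℕ) (φ : MSO n) :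
    (∀ i ∈ fv1 (close N φ), i ∈ fv1 φ ∧ N ≤ i) ∧ ∀ j ∈ fv2 (close N φ), j ∈ fv2 φ ∧ N ≤ j := by
  induction N with
  | zero => simp [close]
  | succ N ih =>
    change (∀ i ∈ fv1 (close N φ) \ {N}, _) ∧ ∀ j ∈ fv2 (close N φ) \ {N}, _
    grind

theorem isSentence_close (φ : MSO n) : IsSentence (close (encode φ + 1) φ) := by
  have h := mem_fv_close (encode φ + 1) φ
  have h' := le_encode φ
  constructor <;> refine Finset.eq_empty_of_forall_notMem fun i hi => ?_
  · have := h.1 i hi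
    have := h'.1 i this.1
    omega
  · have := h.2 i hi
    have := h'.2 i this.1
    omega

theorem sat_close {A : Type} [Nonempty A] {r : A → A → Prop} {P : Fin n → Set A} {φ : MSO n}
    {q : Prop} (h : ∀ v V, Sat r P v V φ ↔ q) (N : ℕ) (v : ℕ → A) (V : ℕ → Set A) :
    Sat r P v V (close N φ) ↔ q := by
  induction N generalizing v V with
  | zero => exact h v V
  | succ N ih =>
    change (∃ a S, Sat r P _ _ (close N φ)) ↔ q
    simp [ih]

/-- The theory decides every formula whose truth value does not depend on the assignment. -/
theorem encode_close_mem_theoryCodes {A : Type} [Nonempty A] {r : A → A → Prop}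
    {P : Fin n → Set A} {φ : MSO n} {q : Prop} (h : ∀ v V, Sat r P v V φ ↔ q) :
    encode (close (encode φ + 1) φ) ∈ TheoryCodes r P ↔ q := by
  constructor
  · rintro ⟨ψ, -, e, t⟩
    obtain rfl := encode_injective e
    exact (sat_close h _ _ _).1 (t (fun _ => Classical.arbitrary A) fun _ => ∅)
  · exact fun hq => ⟨_, isSentence_close φ, rfl, fun v V => (sat_close h _ v V).2 hq⟩

/-! ## Game types of intervals -/

/-- Game types with `k` rounds to be played after `r` rounds. -/
def GameType (n : ℕ) : ℕ → ℕ → Type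
  | 0, r => Fin r → Fin r → Prop × Prop × (Fin n → Prop)
  | k + 1, r => Set (GameType n k (r + 1))

theorem finite_gameType (k r : ℕ) : Finite (GameType n k r) := by
  induction k generalizing r with
  | zero => exact inferInstanceAs (Finite (Fin r → Fin r → Prop × Prop × (Fin n → Prop)))
  | succ k ih =>
    have := ih (r + 1)
    exact inferInstanceAs (Finite (Set (GameType n k (r + 1))))

/-- The game type with `k` remaining rounds of the interval `[a, b)` of `(ℕ, <, P)`, where `v` and
`V` list the points and sets chosen in the first `r` rounds. -/
def gameType (P : Fin n → Set ℕ) (a b : ℕ) :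
    (k r : ℕ) → (ℕ → ℕ) → (ℕ → Set ℕ) → GameType n k r
  | 0, _, v, V => fun i j => (v i < v j, v i ∈ V j, fun l => v i ∈ P l)
  | k + 1, r, v, V => {t | ∃ p ∈ Set.Ico a b, ∃ S,
      t = gameType P a b k (r + 1) (Function.update v r p) (Function.update V r S)}

variable {P : Fin n → Set ℕ}

theorem gameType_zero_eq_iff {a b a' b' r : ℕ} {v w : ℕ → ℕ} {V W : ℕ → Set ℕ} :
    gameType P a b 0 r v V = gameType P a' b' 0 r w W ↔
      ∀ i < r, ∀ j < r, (v i < v j ↔ w i < w j) ∧ (v i ∈ V j ↔ w i ∈ W j) ∧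
        ∀ l, v i ∈ P l ↔ w i ∈ P l := by
  constructor
  · intro h i hi j hj
    have h' := congrFun (congrFun h ⟨i, hi⟩) ⟨j, hj⟩
    simp only [gameType, Prod.mk.injEq, funext_iff, eq_iff_iff] at h'
    exact h'
  · intro h
    refine funext fun i => funext fun j => ?_
    have h' := h i i.2 j j.2
    simp only [gameType, Prod.mk.injEq, funext_iff, eq_iff_iff]
    exact h'

theorem gameType_succ_eq_iff {a b a' b' k r : ℕ} {v w : ℕ → ℕ} {V W : ℕ → Set ℕ} :
    gameType P a b (k + 1) r v V = gameType P a' b' (k + 1) r w W ↔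
      (∀ p ∈ Set.Ico a b, ∀ S, ∃ q ∈ Set.Ico a' b', ∃ T,
        gameType P a b k (r + 1) (Function.update v r p) (Function.update V r S) =
        gameType P a' b' k (r + 1) (Function.update w r q) (Function.update W r T)) ∧
      (∀ q ∈ Set.Ico a' b', ∀ T, ∃ p ∈ Set.Ico a b, ∃ S,
        gameType P a b k (r + 1) (Function.update v r p) (Function.update V r S) =
        gameType P a' b' k (r + 1) (Function.update w r q) (Function.update W r T)) := by
  constructor
  · intro h
    have h' := Set.ext_iff.1 (show @Eq (Set (GameType n k (r + 1))) _ _ from h)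
    constructor
    · exact fun p hp S => (h' _).1 ⟨p, hp, S, rfl⟩
    · intro q hq T
      obtain ⟨p, hp, S, e⟩ := (h' _).2 ⟨q, hq, T, rfl⟩
      exact ⟨p, hp, S, e.symm⟩
  · rintro ⟨h, h'⟩
    refine Set.Subset.antisymm ?_ ?_
    · rintro t ⟨p, hp, S, rfl⟩
      exact h p hp S
    · rintro t ⟨q, hq, T, rfl⟩
      obtain ⟨p, hp, S, e⟩ := h' q hq T
      exact ⟨p, hp, S, e.symm⟩

theorem gameType_congr {a b k r : ℕ} {v w : ℕ → ℕ} {V W : ℕ → Set ℕ}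
    (hv : ∀ i < r, v i = w i) (hV : ∀ i < r, V i = W i) :
    gameType P a b k r v V = gameType P a b k r w W := by
  induction k generalizing r v w V W with
  | zero =>
    rw [gameType_zero_eq_iff]
    intro i hi j hj
    simp [hv i hi, hv j hj, hV j hj]
  | succ k ih =>
    have key (p S) :
        gameType P a b k (r + 1) (Function.update v r p) (Function.update V r S) =
        gameType P a b k (r + 1) (Function.update w r p) (Function.update W r S) := by
      apply ih <;> intro i hi <;> by_cases e : i = r <;> simp [e]
      · exact hv i (by omega)
      · exact hV i (by omega)
    exact gameType_succ_eq_iff.2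
      ⟨fun p hp S => ⟨p, hp, S, key p S⟩, fun p hp S => ⟨p, hp, S, key p S⟩⟩

theorem gameType_zero_of_eq {a b a' b' k r : ℕ} (hab : a < b) {v w : ℕ → ℕ}
    {V W : ℕ → Set ℕ} (h : gameType P a b k r v V = gameType P a' b' k r w W) :
    gameType P a b 0 r v V = gameType P a' b' 0 r w W := by
  induction k generalizing r v w V W with
  | zero => exact h
  | succ k ih =>
    obtain ⟨q, -, T, e⟩ := (gameType_succ_eq_iff.1 h).1 a ⟨le_rfl, hab⟩ ∅
    have e' := gameType_zero_eq_iff.1 (ih e)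
    refine gameType_zero_eq_iff.2 fun i hi j hj => ?_
    simpa [hi.ne, hj.ne] using e' i (by omega) j (by omega)

/-- Equality of game types with `k` rounds implies agreement on formulas of quantifier depth at
most `k`. -/
theorem sat_iff_of_gameType_eq {a b a' b' k r : ℕ} (hab : a < b) {v w : ℕ → ℕ}
    {V W : ℕ → Set ℕ} (h : gameType P a b k r v V = gameType P a' b' k r w W) (φ : MSO n)
    (hφ : qd φ ≤ k) (σ τ : ℕ → ℕ) (hσ : ∀ i ∈ fv1 φ, σ i < r) (hτ : ∀ j ∈ fv2 φ, τ j < r)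
    (x : ℕ → Set.Ico a b) (y : ℕ → Set.Ico a' b') (X : ℕ → Set (Set.Ico a b))
    (Y : ℕ → Set (Set.Ico a' b')) (hx : ∀ i ∈ fv1 φ, (x i : ℕ) = v (σ i))
    (hy : ∀ i ∈ fv1 φ, (y i : ℕ) = w (σ i)) (hX : ∀ j ∈ fv2 φ, X j = Subtype.val ⁻¹' V (τ j))
    (hY : ∀ j ∈ fv2 φ, Y j = Subtype.val ⁻¹' W (τ j)) :
    Sat (subRel (· < ·) (Set.Ico a b)) (subPred P (Set.Ico a b)) x X φ ↔
      Sat (subRel (· < ·) (Set.Ico a' b')) (subPred P (Set.Ico a' b')) y Y φ := by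
  induction φ generalizing k r v w V W σ τ x y X Y with
  | lt i j =>
    have h₀ := gameType_zero_eq_iff.1 (gameType_zero_of_eq hab h)
    simp only [fv1, Finset.mem_insert, Finset.mem_singleton, forall_eq_or_imp, forall_eq] at *
    simpa [Sat, subRel, hx, hy] using (h₀ _ hσ.1 _ hσ.2).1
  | pred l i =>
    have h₀ := gameType_zero_eq_iff.1 (gameType_zero_of_eq hab h)
    simp only [fv1, Finset.mem_singleton, forall_eq] at *
    simpa [Sat, subPred, hx, hy] using (h₀ _ hσ _ hσ).2.2 l
  | mem i j =>
    have h₀ := gameType_zero_eq_iff.1 (gameType_zero_of_eq hab h)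
    simp only [fv1, fv2, Finset.mem_singleton, forall_eq] at *
    simpa [Sat, hx, hy, hX, hY] using (h₀ _ hσ _ hτ).2.1
  | not φ ih => exact not_congr (ih h hφ σ τ hσ hτ x y X Y hx hy hX hY)
  | and φ ψ ih ih' =>
    simp only [qd, max_le_iff] at hφ
    simp only [fv1, fv2, Finset.mem_union, or_imp, forall_and] at *
    exact and_congr
      (ih h hφ.1 σ τ hσ.1 hτ.1 x y X Y hx.1 hy.1 hX.1 hY.1)
      (ih' h hφ.2 σ τ hσ.2 hτ.2 x y X Y hx.2 hy.2 hX.2 hY.2)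
  | ex1 i φ ih =>
    obtain ⟨k, rfl⟩ : ∃ l, k = l + 1 := ⟨k - 1, by simp only [qd] at hφ; omega⟩
    simp only [qd, add_le_add_iff_right] at hφ
    simp only [fv1, fv2, Finset.mem_sdiff, Finset.mem_singleton, and_imp] at *
    have key (p : Set.Ico a b) (q : Set.Ico a' b') (S T)
        (e : gameType P a b k (r + 1) (Function.update v r p) (Function.update V r S) =
          gameType P a' b' k (r + 1) (Function.update w r q) (Function.update W r T)) :
        Sat (subRel (· < ·) (Set.Ico a b)) (subPred P (Set.Ico a b))
          (Function.update x i p) X φ ↔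
        Sat (subRel (· < ·) (Set.Ico a' b')) (subPred P (Set.Ico a' b'))
          (Function.update y i q) Y φ := by
      refine ih e hφ (Function.update σ i r) τ ?_ (fun j hj => (hτ j hj).trans (by omega)) _ _ _ _
        ?_ ?_ ?_ ?_
      · grind [Function.update_apply]
      · grind [Function.update_apply]
      · grind [Function.update_apply]
      · intro j hj
        rw [hX j hj, Function.update_of_ne (hτ j hj).ne]
      · intro j hj
        rw [hY j hj, Function.update_of_ne (hτ j hj).ne]
    rw [gameType_succ_eq_iff] at h
    constructor
    · rintro ⟨p, hp⟩
      obtain ⟨q, hq, T, e⟩ := h.1 p p.2 ∅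
      exact ⟨⟨q, hq⟩, (key p ⟨q, hq⟩ _ _ e).1 hp⟩
    · rintro ⟨q, hq⟩
      obtain ⟨p, hp, S, e⟩ := h.2 q q.2 ∅
      exact ⟨⟨p, hp⟩, (key ⟨p, hp⟩ q _ _ e).2 hq⟩
  | ex2 i φ ih =>
    obtain ⟨k, rfl⟩ : ∃ l, k = l + 1 := ⟨k - 1, by simp only [qd] at hφ; omega⟩
    simp only [qd, add_le_add_iff_right] at hφ
    simp only [fv1, fv2, Finset.mem_sdiff, Finset.mem_singleton, and_imp] at *
    have key (p q : ℕ) (S T : Set ℕ)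
        (e : gameType P a b k (r + 1) (Function.update v r p) (Function.update V r S) =
          gameType P a' b' k (r + 1) (Function.update w r q) (Function.update W r T)) :
        Sat (subRel (· < ·) (Set.Ico a b)) (subPred P (Set.Ico a b))
          x (Function.update X i (Subtype.val ⁻¹' S)) φ ↔
        Sat (subRel (· < ·) (Set.Ico a' b')) (subPred P (Set.Ico a' b'))
          y (Function.update Y i (Subtype.val ⁻¹' T)) φ := by
      refine ih e hφ σ (Function.update τ i r) (fun j hj => (hσ j hj).trans (by omega)) ?_ _ _ _ _
        ?_ ?_ ?_ ?_
      · grind [Function.update_apply]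
      · intro j hj
        rw [hx j hj, Function.update_of_ne (hσ j hj).ne]
      · intro j hj
        rw [hy j hj, Function.update_of_ne (hσ j hj).ne]
      · grind [Function.update_apply]
      · grind [Function.update_apply]
    rw [gameType_succ_eq_iff] at h
    constructor
    · rintro ⟨S, hS⟩
      obtain ⟨q, hq, T, e⟩ := h.1 a ⟨le_rfl, hab⟩ (Subtype.val '' S)
      refine ⟨_, (key _ _ _ _ e).1 ?_⟩
      rwa [Set.preimage_image_eq _ Subtype.val_injective]
    · rintro ⟨T, hT⟩
      obtain ⟨p, hp, S, e⟩ := h.2 (y 0) (y 0).2 (Subtype.val '' T)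
      refine ⟨_, (key _ _ _ _ e).2 ?_⟩
      rwa [Set.preimage_image_eq _ Subtype.val_injective]

/-- The game type of the interval `[a, b)` at the start of a game with `k` rounds. -/
def intervalType (P : Fin n → Set ℕ) (k a b : ℕ) : GameType n k 0 :=
  gameType P a b k 0 (fun _ => 0) fun _ => ∅

theorem equivType_of_intervalType_eq {k a b a' b' : ℕ} (hab : a < b) (hab' : a' < b')
    (h : intervalType P k a b = intervalType P k a' b') :
    EquivType k (subRel (· < ·) (Set.Ico a b)) (subPred P (Set.Ico a b))
      (subRel (· < ·) (Set.Ico a' b')) (subPred P (Set.Ico a' b')) := by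
  intro φ hs hφ
  have key (x y X Y) := sat_iff_of_gameType_eq hab h φ hφ id id (by simp [hs.1]) (by simp [hs.2])
    x y X Y (by simp [hs.1]) (by simp [hs.1]) (by simp [hs.2]) (by simp [hs.2])
  constructor
  · exact fun t y Y => (key (fun _ => ⟨a, le_rfl, hab⟩) y (fun _ => ∅) Y).1 (t _ _)
  · exact fun t x X => (key x (fun _ => ⟨a', le_rfl, hab'⟩) X (fun _ => ∅)).2 (t _ _)

/-! ## Semantics of the formulas -/

section Semantics

variable {A : Type} {r : A → A → Prop} {P : Fin n → Set A} {v : ℕ → A} {V : ℕ → Set A}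

@[simp] theorem sat_imp {φ ψ : MSO n} :
    Sat r P v V (imp φ ψ) ↔ (Sat r P v V φ → Sat r P v V ψ) := by
  simp [imp, Sat]

@[simp] theorem sat_iff {φ ψ : MSO n} :
    Sat r P v V (iff φ ψ) ↔ (Sat r P v V φ ↔ Sat r P v V ψ) := by
  simp [iff, Sat, iff_def]

@[simp] theorem sat_all1 {i : ℕ} {φ : MSO n} :
    Sat r P v V (all1 i φ) ↔ ∀ a, Sat r P (Function.update v i a) V φ := by
  simp [all1, Sat]

@[simp] theorem sat_all2 {j : ℕ} {φ : MSO n} :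
    Sat r P v V (all2 j φ) ↔ ∀ S, Sat r P v (Function.update V j S) φ := by
  simp [all2, Sat]

end Semantics

section NatSemantics

/-- Satisfaction in `(ℕ, <, P)`. -/
abbrev NatSat (P : Fin n → Set ℕ) (v : ℕ → ℕ) (V : ℕ → Set ℕ) (φ : MSO n) : Prop :=
  Sat (fun x y : ℕ => x < y) P v V φ

variable {v : ℕ → ℕ} {V : ℕ → Set ℕ}

@[simp] theorem natSat_verum : NatSat P v V verum := by
  simp [NatSat, verum, Sat]

theorem natSat_conj {m : ℕ} {f : ℕ → MSO n} :
    NatSat P v V (conj m f) ↔ ∀ i < m, NatSat P v V (f i) := by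
  induction m with
  | zero => simp [conj]
  | succ m ih =>
    change NatSat P v V (f m) ∧ NatSat P v V (conj m f) ↔ _
    rw [ih, Nat.forall_lt_succ_right, and_comm]

theorem natSat_between {a p b : ℕ} :
    NatSat P v V (between a p b) ↔ v p ∈ Set.Ico (v a) (v b) := by
  simp [NatSat, between, Sat]

theorem natSat_sameLabels {i : ℕ} :
    NatSat P v V (sameLabels i) ↔ ∀ l, v (5 + 2 * i) ∈ P l ↔ v (6 + 2 * i) ∈ P l := by
  have key (L : List (Fin n)) : NatSat P v V (L.foldr (fun l ψ =>
      and (iff (pred l (5 + 2 * i)) (pred l (6 + 2 * i))) ψ) verum) ↔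
      ∀ l ∈ L, v (5 + 2 * i) ∈ P l ↔ v (6 + 2 * i) ∈ P l := by
    induction L with
    | nil => simp
    | cons l L ih =>
      rw [List.foldr_cons, List.forall_mem_cons, ← ih]
      simp [NatSat, Sat]
  simp [sameLabels, key]

theorem natSat_agree {a b a' b' m : ℕ} :
    NatSat P v V (agree m) ↔
      gameType P a b 0 m (fun i => v (5 + 2 * i)) (fun i => V (1 + 2 * i)) =
      gameType P a' b' 0 m (fun i => v (6 + 2 * i)) (fun i => V (2 + 2 * i)) := by
  rw [gameType_zero_eq_iff, agree, natSat_conj]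
  simp only [natSat_conj, ← natSat_sameLabels (V := V)]
  simp [NatSat, Sat]

theorem comp_update_var {B : Type} (f : ℕ → B) (c r : ℕ) (x : B) :
    (fun i => Function.update f (c + 2 * r) x (c + 2 * i)) =
      Function.update (fun i => f (c + 2 * i)) r x := by
  funext i
  by_cases h : i = r
  · simp [h]
  · rw [Function.update_of_ne (by omega), Function.update_of_ne h]

theorem comp_update_of_ne {B : Type} (f : ℕ → B) (c d : ℕ) (h : ∀ i, c + 2 * i ≠ d) (x : B) :
    (fun i => Function.update f d x (c + 2 * i)) = fun i => f (c + 2 * i) := by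
  funext i
  rw [Function.update_of_ne (h i)]

theorem natSat_gameRound {s : ℕ} {φ : MSO n} :
    NatSat P v V (gameRound s φ) ↔
      (∀ p ∈ Set.Ico (v 1) (v 2), ∀ S, ∃ q ∈ Set.Ico (v 3) (v 4), ∃ T,
        NatSat P (Function.update (Function.update v (5 + 2 * s) p) (6 + 2 * s) q)
          (Function.update (Function.update V (1 + 2 * s) S) (2 + 2 * s) T) φ) ∧
      (∀ q ∈ Set.Ico (v 3) (v 4), ∀ T, ∃ p ∈ Set.Ico (v 1) (v 2), ∃ S,
        NatSat P (Function.update (Function.update v (5 + 2 * s) p) (6 + 2 * s) q)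
          (Function.update (Function.update V (1 + 2 * s) S) (2 + 2 * s) T) φ) := by
  have c₁ (p q : ℕ) : Function.update (Function.update v (5 + 2 * s) p) (6 + 2 * s) q =
      Function.update (Function.update v (6 + 2 * s) q) (5 + 2 * s) p :=
    Function.update_comm (by omega) _ _ _
  have c₂ (S T : Set ℕ) : Function.update (Function.update V (1 + 2 * s) S) (2 + 2 * s) T =
      Function.update (Function.update V (2 + 2 * s) T) (1 + 2 * s) S :=
    Function.update_comm (by omega) _ _ _
  have n₁ (a c x : ℕ) (f : ℕ → ℕ) (h : a < c) : Function.update f (c + 2 * s) x a = f a :=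
    Function.update_of_ne (by omega) _ _
  refine and_congr ?_ ?_
  · simp only [sat_all1, sat_imp, sat_all2, Sat]
    simp only [natSat_between, Function.update_self, n₁, Nat.reduceLT]
  · simp only [sat_all1, sat_imp, sat_all2, Sat]
    simp only [natSat_between, Function.update_self, n₁, Nat.reduceLT, c₁, c₂]

theorem natSat_game {i s : ℕ} :
    NatSat P v V (game (s + i) i) ↔
      gameType P (v 1) (v 2) i s (fun i => v (5 + 2 * i)) (fun i => V (1 + 2 * i)) =
      gameType P (v 3) (v 4) i s (fun i => v (6 + 2 * i)) (fun i => V (2 + 2 * i)) := by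
  induction i generalizing s v V with
  | zero => exact natSat_agree
  | succ i ih =>
    change NatSat P v V (gameRound (s + (i + 1) - (i + 1)) (game (s + (i + 1)) i)) ↔ _
    have n₁ (a c x : ℕ) (f : ℕ → ℕ) (h : a < c) : Function.update f (c + 2 * s) x a = f a :=
      Function.update_of_ne (by omega) _ _
    have m₁ (f : ℕ → ℕ) (x) := comp_update_of_ne f 5 (6 + 2 * s) (by omega) x
    have m₂ (f : ℕ → ℕ) (x) := comp_update_of_ne f 6 (5 + 2 * s) (by omega) x
    have m₃ (f : ℕ → Set ℕ) (x) := comp_update_of_ne f 1 (2 + 2 * s) (by omega) x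
    have m₄ (f : ℕ → Set ℕ) (x) := comp_update_of_ne f 2 (1 + 2 * s) (by omega) x
    rw [Nat.add_sub_cancel, natSat_gameRound, gameType_succ_eq_iff,
      show s + (i + 1) = s + 1 + i by omega]
    simp only [ih, n₁, Nat.reduceLT, comp_update_var, m₁, m₂, m₃, m₄]

/-- All intervals of `X` from `j` on have the same game type with `k` rounds. -/
def HomFrom (P : Fin n → Set ℕ) (k j : ℕ) (X : Set ℕ) : Prop :=
  ∀ a b a' b', j ≤ a → a < b → a ∈ X → b ∈ X → j ≤ a' → a' < b' → a' ∈ X → b' ∈ X →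
    intervalType P k a b = intervalType P k a' b'

theorem natSat_hom {k : ℕ} : NatSat P v V (hom k) ↔ HomFrom P k (v 0) (V 0) := by
  have key (v : ℕ → ℕ) : NatSat P v V (game k k) ↔
      intervalType P k (v 1) (v 2) = intervalType P k (v 3) (v 4) := by
    have h := natSat_game (P := P) (v := v) (V := V) (i := k) (s := 0)
    rw [Nat.zero_add] at h
    rw [h]
    refine Eq.congr ?_ ?_ <;> exact gameType_congr (by simp) (by simp)
  simp only [NatSat] at key
  simp [NatSat, hom, HomFrom, Sat, key]

theorem natSat_literal {m : ℕ} : NatSat P v V (literal m) ↔ v (m + 1) = m := by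
  induction m generalizing v with
  | zero =>
    simp only [NatSat, literal, Sat]
    simp
    exact ⟨fun h => Nat.le_zero.1 (h 0), fun h => by omega⟩
  | succ m ih =>
    change (∃ a, NatSat P (Function.update v (m + 1) a) V (literal m) ∧ _ ∧
      ¬ ∃ z : ℕ, _ ∧ _) ↔ _
    simp only [ih, Sat]
    simp
    change _ ↔ v (m + 2) = m + 1
    refine ⟨fun ⟨h, h'⟩ => ?_, fun h => ⟨by omega, fun x hx => by omega⟩⟩
    have := h' (m + 1) (by omega)
    omega

theorem natSat_isNum {m : ℕ} : NatSat P v V (isNum m) ↔ v 0 = m := by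
  change (∃ a, NatSat P (Function.update v (m + 1) a) V (literal m) ∧ _ ∧ _) ↔ _
  simp only [natSat_literal, Sat]
  simp
  omega

theorem natSat_accept {k m : ℕ} {φ : MSO n} :
    NatSat P v V (accept k m φ) ↔ NatSat P v V φ ∧ m ∈ V 0 ∧ HomFrom P k m (V 0) := by
  refine and_congr Iff.rfl ?_
  change (∃ a, NatSat P (Function.update v 0 a) V (isNum m) ∧ _ ∧
    NatSat P (Function.update v 0 a) V (hom k)) ↔ _
  simp [natSat_isNum, natSat_hom, Sat]

theorem natSat_reject {m : ℕ} {φ : MSO n} :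
    NatSat P v V (reject m φ) ↔ NatSat P v V φ ∧ m ∉ V 0 := by
  refine and_congr Iff.rfl (not_congr ?_)
  change (∃ a, NatSat P (Function.update v 0 a) V (isNum m) ∧ _) ↔ _
  simp [natSat_isNum, Sat]

theorem natSat_someInfinite {φ : MSO n} {Q : Set ℕ → Prop}
    (h : ∀ v V, NatSat P v V φ ↔ Q (V 0)) :
    NatSat P v V (someInfinite φ) ↔ ∃ X : Set ℕ, X.Infinite ∧ Q X := by
  change (∃ S, NatSat P _ _ _ ∧ NatSat P _ _ φ) ↔ _
  simp only [h, NatSat, sat_all1, Sat]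
  refine exists_congr fun X => and_congr ?_ (by simp)
  rw [Set.infinite_iff_exists_gt]
  simp [and_comm]

end NatSemantics

end MSO

/-! ## Ramsey's theorem for pairs -/

theorem exists_infinite_homogeneous {C : Type*} [Finite C] (c : ℕ → ℕ → C) {X : Set ℕ}
    (hX : X.Infinite) :
    ∃ Y ⊆ X, Y.Infinite ∧ ∃ t, ∀ a ∈ Y, ∀ b ∈ Y, a < b → c a b = t := by
  have : (Filter.cofinite ⊓ Filter.principal X).NeBot := by
    rwa [Filter.cofinite_inf_principal_neBot_iff]
  obtain ⟨U, hU⟩ := Ultrafilter.exists_le (Filter.cofinite ⊓ Filter.principal X)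
  rw [le_inf_iff, Filter.le_principal_iff] at hU
  have hgt (a : ℕ) : ∀ᶠ b in U, a < b :=
    hU.1 (Filter.mem_cofinite.2 ((Set.finite_Iic a).subset fun b hb => by simpa using hb))
  have limit (f : ℕ → C) : ∃ t, ∀ᶠ b in U, f b = t := by
    obtain ⟨t, ht⟩ := (U.map f).eq_pure_of_finite
    refine ⟨t, ?_⟩
    have h : {t} ∈ U.map f := by
      rw [ht]
      exact Set.mem_singleton t
    exact h
  choose d hd using fun a => limit (c a)
  obtain ⟨t, ht⟩ := limit d
  obtain ⟨f, hf, hf'⟩ := exists_seq_of_forall_finset_exists (fun a => a ∈ X ∧ d a = t)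
    (fun a b => a < b ∧ c a b = t) fun s hs => by
      have h : ∀ᶠ b in U, ∀ a ∈ s, a < b ∧ c a b = t := by
        refine (Filter.eventually_all_finset s).2 fun a ha => ?_
        filter_upwards [hgt a, hd a] with b h₁ h₂
        exact ⟨h₁, h₂.trans (hs a ha).2⟩
      obtain ⟨b, h₁, h₂⟩ := (((show ∀ᶠ b in U, b ∈ X from hU.2).and ht).and h).exists
      exact ⟨b, h₁, h₂⟩
  have mono : StrictMono f := fun i j hij => (hf' i j hij).1
  refine ⟨Set.range f, ?_, Set.infinite_range_of_injective mono.injective, t, ?_⟩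
  · rintro _ ⟨i, rfl⟩
    exact (hf i).1
  · rintro _ ⟨i, rfl⟩ _ ⟨j, rfl⟩ hij
    exact (hf' i j (mono.lt_iff_lt.1 hij)).2

/-! ## The greedy homogeneous set -/

namespace MSO

variable {n : ℕ}

/-- The greedy construction: the number of elements below `m` that were accepted, and a formula
recording the conditions on `X₀` collected so far. -/
noncomputable def greedy (P : Fin n → Set ℕ) : ℕ → ℕ × MSO n
  | 0 => (0, verum)
  | m + 1 =>
    open Classical in
    if TrueIn (fun x y : ℕ => x < y) P
        (someInfinite (accept (greedy P m).1 m (greedy P m).2)) then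
      ((greedy P m).1 + 1, accept (greedy P m).1 m (greedy P m).2)
    else ((greedy P m).1, reject m (greedy P m).2)

/-- The set of numbers accepted by the greedy construction. -/
def greedySet (P : Fin n → Set ℕ) : Set ℕ :=
  {m | TrueIn (fun x y : ℕ => x < y) P (someInfinite (accept (greedy P m).1 m (greedy P m).2))}

variable {P : Fin n → Set ℕ}

theorem HomFrom.mono {k j : ℕ} {X Y : Set ℕ} (h : HomFrom P k j X)
    (hY : ∀ a ∈ Y, j ≤ a → a ∈ X) : HomFrom P k j Y := by
  intro a b a' b' h₁ h₂ h₃ h₄ h₅ h₆ h₇ h₈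
  exact h a b a' b' h₁ h₂ (hY a h₃ h₁) (hY b h₄ (by omega)) h₅ h₆ (hY a' h₇ h₅)
    (hY b' h₈ (by omega))

/-- The conditions on a set imposed by the first `m` steps of the greedy construction. -/
def Compatible (P : Fin n → Set ℕ) (m : ℕ) (X : Set ℕ) : Prop :=
  open Classical in
  ∀ j < m, (j ∈ X ↔ j ∈ greedySet P) ∧
    (j ∈ greedySet P → HomFrom P (Nat.count (· ∈ greedySet P) j) j X)

theorem compatible_succ {m : ℕ} {X : Set ℕ} :
    open Classical in
    Compatible P (m + 1) X ↔ Compatible P m X ∧ (m ∈ X ↔ m ∈ greedySet P) ∧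
      (m ∈ greedySet P → HomFrom P (Nat.count (· ∈ greedySet P) m) m X) := by
  exact Nat.forall_lt_succ_right

theorem greedy_succ_of_mem {m : ℕ} (h : m ∈ greedySet P) :
    greedy P (m + 1) = ((greedy P m).1 + 1, accept (greedy P m).1 m (greedy P m).2) := by
  rw [greedy]
  exact if_pos h

theorem greedy_succ_of_notMem {m : ℕ} (h : m ∉ greedySet P) :
    greedy P (m + 1) = ((greedy P m).1, reject m (greedy P m).2) := by
  rw [greedy]
  exact if_neg h

open Classical in
theorem greedy_fst (m : ℕ) : (greedy P m).1 = Nat.count (· ∈ greedySet P) m := by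
  induction m with
  | zero => rfl
  | succ m ih =>
    by_cases h : m ∈ greedySet P
    · simp [greedy_succ_of_mem h, Nat.count_succ, h, ih]
    · simp [greedy_succ_of_notMem h, Nat.count_succ, h, ih]

theorem natSat_greedy {m : ℕ} {v : ℕ → ℕ} {V : ℕ → Set ℕ} :
    NatSat P v V (greedy P m).2 ↔ Compatible P m (V 0) := by
  induction m with
  | zero => exact iff_of_true natSat_verum fun j hj => by omega
  | succ m ih =>
    rw [compatible_succ, ← ih]
    by_cases h : m ∈ greedySet P
    · simp only [greedy_succ_of_mem h, natSat_accept, greedy_fst, h, iff_true, true_imp_iff]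
    · simp only [greedy_succ_of_notMem h, natSat_reject, h, iff_false, false_imp_iff, and_true]

open Classical in
theorem natSat_query {m : ℕ} {v : ℕ → ℕ} {V : ℕ → Set ℕ} :
    NatSat P v V (someInfinite (accept (greedy P m).1 m (greedy P m).2)) ↔
      ∃ X : Set ℕ, X.Infinite ∧ Compatible P m X ∧ m ∈ X ∧
        HomFrom P (Nat.count (· ∈ greedySet P) m) m X := by
  refine natSat_someInfinite (Q := fun X => Compatible P m X ∧ m ∈ X ∧
    HomFrom P (Nat.count (· ∈ greedySet P) m) m X) fun v V => ?_
  rw [natSat_accept, natSat_greedy, greedy_fst]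

open Classical in
theorem mem_greedySet_iff {m : ℕ} :
    m ∈ greedySet P ↔ ∃ X : Set ℕ, X.Infinite ∧ Compatible P m X ∧ m ∈ X ∧
      HomFrom P (Nat.count (· ∈ greedySet P) m) m X :=
  ⟨fun h => natSat_query.1 (h (fun _ => 0) fun _ => ∅), fun h _ _ => natSat_query.2 h⟩

theorem exists_compatible (m : ℕ) : ∃ X : Set ℕ, X.Infinite ∧ Compatible P m X := by
  induction m with
  | zero => exact ⟨Set.univ, Set.infinite_univ, fun j hj => by omega⟩
  | succ m ih =>
    by_cases h : m ∈ greedySet P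
    · obtain ⟨X, h₁, h₂, h₃, h₄⟩ := mem_greedySet_iff.1 h
      exact ⟨X, h₁, compatible_succ.2 ⟨h₂, iff_of_true h₃ h, fun _ => h₄⟩⟩
    · obtain ⟨X, h₁, h₂⟩ := ih
      refine ⟨X \ {m}, h₁.sdiff (Set.finite_singleton m), compatible_succ.2
        ⟨fun j hj => ⟨?_, fun hj' => ((h₂ j hj).2 hj').mono fun a ha _ => ha.1⟩, ?_, ?_⟩⟩
      · simpa [hj.ne] using (h₂ j hj).1
      · simp [h]
      · exact fun h' => (h h').elim

theorem greedySet_infinite : (greedySet P).Infinite := by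
  classical
  rw [Set.infinite_iff_exists_gt]
  by_contra! hbound
  obtain ⟨m, hm⟩ := hbound
  obtain ⟨X, hX, hc⟩ := exists_compatible (P := P) (m + 1)
  have := finite_gameType (n := n) (Nat.count (· ∈ greedySet P) (m + 1)) 0
  obtain ⟨Y, hYX, hY, t, ht⟩ := exists_infinite_homogeneous
    (intervalType P (Nat.count (· ∈ greedySet P) (m + 1))) (hX.sdiff (Set.finite_Iic m))
  obtain ⟨y, hyY, hy⟩ : ∃ y ∈ Y, ∀ z ∈ Y, y ≤ z :=
    ⟨sInf Y, Nat.sInf_mem hY.nonempty, fun z hz => Nat.sInf_le hz⟩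
  have hmY (z) (hz : z ∈ Y) : z ∈ X ∧ m < z := by simpa using hYX hz
  have hcount : Nat.count (· ∈ greedySet P) y = Nat.count (· ∈ greedySet P) (m + 1) := by
    obtain ⟨d, rfl⟩ := Nat.exists_eq_add_of_lt (hmY y hyY).2
    rw [show m + d + 1 = m + 1 + d by omega, Nat.count_add]
    simp only [Nat.add_eq_left, Nat.count_eq_card_filter_range, Finset.card_eq_zero,
      Finset.filter_eq_empty_iff]
    intro i _ hi
    have := hm _ hi
    omega
  have hmem : y ∈ greedySet P := by
    refine mem_greedySet_iff.2 ⟨X ∩ Set.Iic m ∪ Y, hY.mono Set.subset_union_right,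
      fun j hj => ?_, Or.inr hyY, ?_⟩
    · have hjY : j ∉ Y := fun h => (hy j h).not_gt hj
      by_cases hjm : j ≤ m
      · refine ⟨by simpa [hjY, hjm] using (hc j (by omega)).1,
          fun hj' => ((hc j (by omega)).2 hj').mono ?_⟩
        rintro a (ha | ha) -
        · exact ha.1
        · exact (hmY a ha).1
      · have hj' : j ∉ greedySet P := fun h => hjm (hm j h)
        exact ⟨by simp [hjY, hjm, hj'], fun h => (hj' h).elim⟩
    · rw [hcount]
      have key (a) (ha : a ∈ X ∩ Set.Iic m ∪ Y) (hya : y ≤ a) : a ∈ Y := by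
        refine ha.resolve_left fun h => ?_
        have h₁ : a ≤ m := h.2
        have h₂ := (hmY y hyY).2
        omega
      intro a b a' b' h₁ h₂ h₃ h₄ h₅ h₆ h₇ h₈
      rw [ht a (key a h₃ h₁) b (key b h₄ (by omega)) h₂,
        ht a' (key a' h₇ h₅) b' (key b' h₈ (by omega)) h₆]
  exact absurd (hm y hmem) (hmY y hyY).2.not_ge

open Classical in
theorem homFrom_greedySet {m : ℕ} (hm : m ∈ greedySet P) :
    HomFrom P (Nat.count (· ∈ greedySet P) m) m (greedySet P) := by
  intro a b a' b' h₁ h₂ h₃ h₄ h₅ h₆ h₇ h₈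
  obtain ⟨X, -, hX⟩ := exists_compatible (P := P) (b + b' + 1)
  have hmX := (hX m (by omega)).2 hm
  exact hmX a b a' b' h₁ h₂ ((hX a (by omega)).1.2 h₃) ((hX b (by omega)).1.2 h₄) h₅ h₆
    ((hX a' (by omega)).1.2 h₇) ((hX b' (by omega)).1.2 h₈)

theorem uniformlyHomogeneous_nth_greedySet :
    UniformlyHomogeneous P (Nat.nth (· ∈ greedySet P)) := by
  classical
  have mono := Nat.nth_strictMono (p := (· ∈ greedySet P)) greedySet_infinite
  have hmem (i : ℕ) : Nat.nth (· ∈ greedySet P) i ∈ greedySet P :=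
    Nat.nth_mem_of_infinite greedySet_infinite i
  refine ⟨mono, fun k i j i' j' hij hij' => ?_⟩
  have h := homFrom_greedySet (hmem k)
  rw [Nat.count_nth_of_infinite (p := (· ∈ greedySet P)) greedySet_infinite] at h
  have h₁ := mono (show k + i < k + j by omega)
  have h₂ := mono (show k + i' < k + j' by omega)
  exact equivType_of_intervalType_eq h₁ h₂
    (h _ _ _ _ (mono.monotone (by omega)) h₁ (hmem _) (hmem _)
      (mono.monotone (by omega)) h₂ (hmem _) (hmem _))

end MSO

/-! ## Relative computability of iterations with an oracle -/

namespace RecursiveIn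

variable {O : ℕ →. ℕ}

theorem of_partrec {f : ℕ →. ℕ} (hf : Nat.Partrec f) : RecursiveIn O f := by
  induction hf with
  | zero => exact zero
  | succ => exact succ
  | left => exact left
  | right => exact right
  | pair _ _ ih ih' => exact pair ih ih'
  | comp _ _ ih ih' => exact comp ih ih'
  | prec _ _ ih ih' => exact prec ih ih'
  | rfind _ ih => exact rfind ih

theorem of_primrec {f : ℕ → ℕ} (hf : Primrec f) : RecursiveIn O (fun m => Part.some (f m)) :=
  of_partrec (Nat.Partrec.of_primrec (Primrec.nat_iff.1 hf))

theorem comp_some {f g : ℕ → ℕ} (hf : RecursiveIn O (fun m => Part.some (f m)))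
    (hg : RecursiveIn O (fun m => Part.some (g m))) :
    RecursiveIn O (fun m => Part.some (f (g m))) := by
  simpa using hf.comp hg

theorem pair_some {f g : ℕ → ℕ} (hf : RecursiveIn O (fun m => Part.some (f m)))
    (hg : RecursiveIn O (fun m => Part.some (g m))) :
    RecursiveIn O (fun m => Part.some (Nat.pair (f m) (g m))) := by
  simpa [Seq.seq] using hf.pair hg

theorem iterate_some {s : ℕ → ℕ} {g : ℕ → ℕ} (hg : RecursiveIn O (fun m => Part.some (g m)))
    (hs : ∀ m, s (m + 1) = g (Nat.pair m (s m))) : RecursiveIn O (fun m => Part.some (s m)) := by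
  have hg' : RecursiveIn O (fun m => Part.some (g m.unpair.2)) :=
    hg.comp_some (f := g) (g := fun m => m.unpair.2) right
  have h := (prec (of_primrec (Primrec.const (s 0))) hg').comp
    (pair_some (f := fun _ => 0) (g := fun m => m) (of_primrec (Primrec.const 0))
      (of_primrec Primrec.id))
  refine cast (congrArg (RecursiveIn O) (funext fun m => ?_)) h
  symm
  simp only [Part.bind_eq_bind, Part.bind_some, Nat.unpaired, Nat.unpair_pair]
  induction m with
  | zero => rfl
  | succ m ih => simp [← ih, hs]

end RecursiveIn

/-- A set decided along an iteration that consults the oracle once per step is recursive in the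
oracle. -/
theorem turingRed_of_iteration {S T : Set ℕ} {s : ℕ → ℕ} {q : ℕ → ℕ} {g : ℕ → ℕ}
    (hq : Primrec q) (hg : Primrec g)
    (hs : ∀ m, s (m + 1) =
      g (Nat.pair (Nat.pair m (s m)) (T.indicator (fun _ => 1) (q (Nat.pair m (s m))))))
    (hS : ∀ m, m ∈ S ↔ q (Nat.pair m (s m)) ∈ T) : TuringRed S T := by
  have oracle_q : RecursiveIn (chi T)
      (fun z => Part.some (T.indicator (fun _ => 1) (q z) : ℕ)) :=
    RecursiveIn.comp_some (f := T.indicator fun _ => 1) RecursiveIn.oracle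
      (RecursiveIn.of_primrec hq)
  have hstate : RecursiveIn (chi T) (fun m => Part.some (s m)) :=
    RecursiveIn.iterate_some (RecursiveIn.comp_some (RecursiveIn.of_primrec hg)
      (RecursiveIn.pair_some (RecursiveIn.of_primrec Primrec.id) oracle_q)) hs
  have h := RecursiveIn.comp_some oracle_q
    (RecursiveIn.pair_some (RecursiveIn.of_primrec Primrec.id) hstate)
  unfold TuringRed
  refine cast (congrArg (RecursiveIn (chi T)) (funext fun m => ?_)) h
  by_cases hm : m ∈ S
  · simp [chi, hm, (hS m).1 hm]
  · simp [chi, hm, (hS m).not.1 hm]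

namespace MSO

variable {n : ℕ} {P : Fin n → Set ℕ}

theorem turingRed_greedySet :
    TuringRed (greedySet P) (TheoryCodes (fun x y : ℕ => x < y) P) := by
  obtain ⟨acc, hacc, eacc⟩ := primOp_accept (n := n)
  obtain ⟨rej, hrej, erej⟩ := primOp_reject (n := n)
  obtain ⟨inf, hinf, einf⟩ := primOp_someInfinite (n := n)
  obtain ⟨cl, hcl, ecl⟩ := primOp_close (n := n)
  have hl : Primrec (fun z : ℕ => z.unpair.1) := Primrec.fst.comp Primrec.unpair
  have hr : Primrec (fun z : ℕ => z.unpair.2) := Primrec.snd.comp Primrec.unpair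
  have hA : Primrec (fun z : ℕ =>
      acc (z.unpair.2.unpair.1, z.unpair.1) z.unpair.2.unpair.2) :=
    hacc.comp (Primrec.pair (hl.comp hr) hl) (hr.comp hr)
  have hI := hinf.comp (Primrec.const 0) hA
  have hR : Primrec (fun z : ℕ => rej z.unpair.1 z.unpair.2.unpair.2) :=
    hrej.comp hl (hr.comp hr)
  have hquery (m : ℕ) : m ∈ greedySet P ↔
      cl (inf 0 (acc ((greedy P m).1, m) (greedy P m).2.encode) + 1)
        (inf 0 (acc ((greedy P m).1, m) (greedy P m).2.encode)) ∈
        TheoryCodes (fun x y : ℕ => x < y) P := by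
    rw [← eacc ((greedy P m).1, m), ← einf, ← ecl, mem_greedySet_iff]
    exact (encode_close_mem_theoryCodes fun v V => natSat_query).symm
  refine turingRed_of_iteration
    (s := fun m => Nat.pair (greedy P m).1 (greedy P m).2.encode)
    (q := fun z => cl (inf 0 (acc (z.unpair.2.unpair.1, z.unpair.1) z.unpair.2.unpair.2) + 1)
      (inf 0 (acc (z.unpair.2.unpair.1, z.unpair.1) z.unpair.2.unpair.2)))
    (g := fun z => if z.unpair.2 = 0 then
      Nat.pair z.unpair.1.unpair.2.unpair.1 (rej z.unpair.1.unpair.1 z.unpair.1.unpair.2.unpair.2)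
      else Nat.pair (z.unpair.1.unpair.2.unpair.1 + 1)
        (acc (z.unpair.1.unpair.2.unpair.1, z.unpair.1.unpair.1) z.unpair.1.unpair.2.unpair.2))
    (hcl.comp (Primrec.succ.comp hI) hI) ?_ ?_ ?_
  · exact Primrec.ite (PrimrecRel.comp Primrec.eq hr (Primrec.const 0))
      (Primrec₂.natPair.comp (hl.comp (hr.comp hl)) (hR.comp hl))
      (Primrec₂.natPair.comp (Primrec.succ.comp (hl.comp (hr.comp hl))) (hA.comp hl))
  · intro m
    simp only [Nat.unpair_pair]
    by_cases h : m ∈ greedySet P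
    · rw [Set.indicator_of_mem ((hquery m).1 h), greedy_succ_of_mem h, if_neg one_ne_zero,
        ← eacc]
    · rw [Set.indicator_of_notMem ((hquery m).not.1 h), greedy_succ_of_notMem h, if_pos rfl,
        ← erej]
  · intro m
    simpa using hquery m

end MSO

end Paper

open Paper

/-- For every labelled linear ordering `M = (ℕ, <, P₁, …, Pₙ)` there is a set
`H = {h 0 < h 1 < ⋯} ⊆ ℕ` that is uniformly homogeneous for `M` and recursive
in (Turing reducible to) the MSO theory of `M`. -/
theorem stmt_13 {n : ℕ} (P : Fin n → Set ℕ) :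
    ∃ h : ℕ → ℕ, UniformlyHomogeneous P h ∧
      TuringRed (Set.range h) (MSO.TheoryCodes (fun x y : ℕ => x < y) P) := by
  refine ⟨Nat.nth (· ∈ MSO.greedySet P), MSO.uniformlyHomogeneous_nth_greedySet, ?_⟩
  rw [Nat.range_nth_of_infinite (p := (· ∈ MSO.greedySet P)) MSO.greedySet_infinite]
  exact MSO.turingRed_greedySet
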